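/- A sequence (x_α)_{α<μ} of unit vectors in a Banach space X is 1-suppression unconditional (i.e., ‖Σ_{α∈A} c_α x_α‖ ≤ ‖Σ_{α∈B} c_α x_α‖ for all finite A ⊂ B ⊂ μ and all real coefficients) if and only if for every β < μ, the annihilator [x_β]^⊥ = {f ∈ X* : f(x_β) = 0} 1-norms the closed linear span of {x_α : α ≠ β}, meaning for every y in that span, ‖y‖ = sup{|f(y)| : f ∈ [x_β]^⊥, ‖f‖ ≤ 1}. -/

import Mathlib

open Finset

lemma aux_dual {X : Type*} [NormedAddCommGroup X] [NormedSpace ℝ X] (z y : X)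
    (h : ∀ t : ℝ, ‖y‖ ≤ ‖y + t • z‖) :
    ∃ f : X →L[ℝ] ℝ, f z = 0 ∧ ‖f‖ ≤ 1 ∧ f y = ‖y‖ := by
  let S : Submodule ℝ X := Submodule.span ℝ {z}
  obtain ⟨g, hg, hgy⟩ := exists_dual_vector'' ℝ (S.mkQ y)
  have hq : ∀ v : X, ‖S.mkQ v‖ ≤ 1 * ‖v‖ := by
    intro v
    rw [one_mul]
    exact Submodule.Quotient.norm_mk_le S v
  let q : X →L[ℝ] X ⧸ S := S.mkQ.mkContinuous 1 hq
  have hqn : ‖q‖ ≤ 1 := LinearMap.mkContinuous_norm_le _ zero_le_one _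
  have hle : ‖y‖ ≤ ‖S.mkQ y‖ := by
    refine le_of_forall_pos_lt_add ?_
    intro ε hε
    obtain ⟨m, hm, hlt⟩ := Submodule.Quotient.norm_mk_lt (S := S) (S.mkQ y) hε
    have h1 : m - y ∈ S := (Submodule.Quotient.eq S).1 hm
    obtain ⟨t, ht⟩ := Submodule.mem_span_singleton.1 h1
    have h2 := h t
    rw [ht, add_sub_cancel] at h2
    exact h2.trans_lt hlt
  have hle2 : ‖S.mkQ y‖ ≤ ‖y‖ := Submodule.Quotient.norm_mk_le S y
  refine ⟨g.comp q, ?_, ?_, ?_⟩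
  · have : q z = 0 := (Submodule.Quotient.mk_eq_zero S).2 (Submodule.mem_span_singleton_self z)
    simp [this]
  · exact (g.opNorm_comp_le q).trans (mul_le_one₀ hg (norm_nonneg _) hqn)
  · change g (S.mkQ y) = _
    rw [hgy]
    exact le_antisymm hle2 hle

/-- A sequence of unit vectors is 1-suppression unconditional iff for each β the
annihilator of x β 1-norms the closed span of the other vectors. -/
theorem one_suppression_iff_annihilator_one_norms
    {X : Type*} [NormedAddCommGroup X] [NormedSpace ℝ X] [CompleteSpace X]
    {ι : Type*} (x : ι → X) (hx : ∀ α, ‖x α‖ = 1) :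
    (∀ (A B : Finset ι), A ⊆ B → ∀ c : ι → ℝ,
        ‖∑ α ∈ A, c α • x α‖ ≤ ‖∑ α ∈ B, c α • x α‖)
    ↔ (∀ β : ι, ∀ y ∈ (Submodule.span ℝ {v | ∃ α, α ≠ β ∧ v = x α}).topologicalClosure,
        ‖y‖ = sSup {r : ℝ | ∃ f : X →L[ℝ] ℝ, f (x β) = 0 ∧ ‖f‖ ≤ 1 ∧ r = |f y|}) := by
  classical
  constructor
  · intro H β y hy
    have key : ∀ t : ℝ, ‖y‖ ≤ ‖y + t • x β‖ := by
      intro t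
      have hc : IsClosed {v : X | ‖v‖ ≤ ‖v + t • x β‖} :=
        isClosed_le (by fun_prop) (by fun_prop)
      refine closure_minimal ?_ hc hy
      intro v hv
      have hs : {v | ∃ α, α ≠ β ∧ v = x α} = x '' {α | α ≠ β} := by
        ext v
        simp [eq_comm]
      replace hv : v ∈ Submodule.span ℝ {v | ∃ α, α ≠ β ∧ v = x α} := hv
      rw [hs, Finsupp.mem_span_image_iff_linearCombination] at hv
      obtain ⟨l, hl, rfl⟩ := hv
      have hβ : β ∉ l.support := fun hmem => (hl hmem) rfl
      have h1 := H l.support (insert β l.support) (Finset.subset_insert _ _)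
        (Function.update l β t)
      have h2 : ∑ α ∈ l.support, Function.update l β t α • x α
          = Finsupp.linearCombination ℝ x l := by
        rw [Finsupp.linearCombination_apply, Finsupp.sum]
        refine Finset.sum_congr rfl fun α hα => ?_
        rw [Function.update_of_ne]
        rintro rfl
        exact hβ hα
      rw [Finset.sum_insert hβ, h2, Function.update_self, add_comm] at h1
      exact h1
    obtain ⟨f, hf0, hf1, hfy⟩ := aux_dual (x β) y key
    symm
    refine IsGreatest.csSup_eq ⟨⟨f, hf0, hf1, by rw [hfy, abs_norm]⟩, ?_⟩
    rintro r ⟨g, -, hg, rfl⟩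
    exact (g.le_of_opNorm_le hg y).trans (by rw [one_mul])
  · intro H A B hAB c
    have step : ∀ (s : Finset ι) (β : ι), β ∉ s →
        ‖∑ α ∈ s, c α • x α‖ ≤ ‖∑ α ∈ insert β s, c α • x α‖ := by
      intro s β hβ
      have hy : ∑ α ∈ s, c α • x α ∈
          (Submodule.span ℝ {v | ∃ α, α ≠ β ∧ v = x α}).topologicalClosure := by
        refine Submodule.le_topologicalClosure _ ?_
        refine Submodule.sum_mem _ fun α hα => Submodule.smul_mem _ _ (Submodule.subset_span ?_)
        exact ⟨α, fun h => hβ (h ▸ hα), rfl⟩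
      rw [H β _ hy]
      refine csSup_le ⟨_, 0, by simp, by simp, rfl⟩ ?_
      rintro r ⟨f, hf0, hf1, rfl⟩
      have : f (∑ α ∈ s, c α • x α) = f (∑ α ∈ insert β s, c α • x α) := by
        rw [Finset.sum_insert hβ, map_add, map_smul, hf0, smul_zero, zero_add]
      rw [this]
      exact (f.le_of_opNorm_le hf1 _).trans (by rw [one_mul])
    have gen : ∀ D : Finset ι, ‖∑ α ∈ A, c α • x α‖ ≤ ‖∑ α ∈ D ∪ A, c α • x α‖ := by
      intro D
      induction D using Finset.induction_on with
      | empty => simp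
      | insert β s hβ ih =>
        rw [Finset.insert_union]
        by_cases hm : β ∈ s ∪ A
        · rw [Finset.insert_eq_of_mem hm]
          exact ih
        · exact ih.trans (step _ _ hm)
    have := gen B
    rwa [Finset.union_eq_left.2 hAB] at this
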